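/- Assume (A), (A+), ℓ ∈ C¹(X) and ℓ Lipschitz on bounded subsets of X. Fix ū, u ∈ 𝒰, x₀ ∈ X, α ≥ 0, and define 𝓘, p̄_t and H̄_t as in the exact increment formula. If for almost every t ∈ I the control value u(t) satisfies H̄_t(x^u_t, u(t)) ≤ H̄_t(x^u_t, ū(t)) (in particular if u(t) minimizes 𝑢 ↦ H̄_t(x^u_t, 𝑢) over U), then 𝓘[u] ≤ 𝓘[ū] (monotone descent property). -/

import Mathlib

open MeasureTheory Set Filter
open scoped RealInnerProductSpace

noncomputable section

/-- `φ` is a mild solution on `[s,T]` with initial data `(s, x)` for the semigroup `S`. -/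
def IsMildSol {X : Type*} [NormedAddCommGroup X] [NormedSpace ℝ X]
    (T : ℝ) (S : ℝ → X →L[ℝ] X) (F : ℝ → X → X) (s : ℝ) (x : X) (φ : ℝ → X) : Prop :=
  ContinuousOn φ (Set.Icc s T) ∧
    ∀ t ∈ Set.Icc s T, φ t = S (t - s) x + ∫ τ in s..t, S (t - τ) (F τ (φ τ))
open scoped Topology

lemma aesm_simple {E Y : Type*} [NormedAddCommGroup E] [NormedAddCommGroup Y]
    {μ : Measure ℝ} {F : ℝ → E → Y} (hm : ∀ x, AEStronglyMeasurable (fun t => F t x) μ)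
    (s : SimpleFunc ℝ E) : AEStronglyMeasurable (fun t => F t (s t)) μ := by
  classical
  have : (fun t => F t (s t)) =
      fun t => ∑ y ∈ s.range, (s ⁻¹' {y}).indicator (fun t => F t y) t := by
    funext t
    rw [Finset.sum_eq_single (s t)]
    · simp
    · intro y _ hy
      simp [Set.indicator, hy.symm]
    · intro h
      exact absurd (SimpleFunc.mem_range_self s t) h
  rw [this]
  refine Finset.aestronglyMeasurable_fun_sum _ fun y _ => ?_
  exact (hm y).indicator (s.measurableSet_preimage _)

lemma aesm_carath {E Y : Type*} [NormedAddCommGroup E] [NormedAddCommGroup Y]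
    {μ : Measure ℝ} {F : ℝ → E → Y} (hm : ∀ x, AEStronglyMeasurable (fun t => F t x) μ)
    (hc : ∀ᵐ t ∂μ, Continuous (F t)) {w : ℝ → E} (hw : AEStronglyMeasurable w μ) :
    AEStronglyMeasurable (fun t => F t (w t)) μ := by
  have h1 : AEStronglyMeasurable (fun t => F t (hw.mk w t)) μ := by
    refine aestronglyMeasurable_of_tendsto_ae atTop
      (f := fun n t => F t (hw.stronglyMeasurable_mk.approx n t))
      (fun n => aesm_simple hm _) ?_
    filter_upwards [hc] with t ht
    exact (ht.tendsto _).comp (hw.stronglyMeasurable_mk.tendsto_approx t)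
  refine h1.congr ?_
  filter_upwards [hw.ae_eq_mk] with t ht
  rw [ht]

lemma gronwall_int {r : ℝ → ℝ} {a b A K : ℝ} (hK : 0 ≤ K)
    (hr : ContinuousOn r (Icc a b))
    (h : ∀ t ∈ Icc a b, r t ≤ A + K * ∫ τ in a..t, r τ) :
    ∀ t ∈ Icc a b, r t ≤ A * Real.exp (K * (t - a)) := by
  intro t ht
  have hab : a ≤ b := ht.1.trans ht.2
  set r' : ℝ → ℝ := IccExtend hab ((Icc a b).domRestrict r) with hr'
  have hc : Continuous r' := (continuousOn_iff_continuous_domRestrict.1 hr).Icc_extend'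
  have heq : ∀ t ∈ Icc a b, r' t = r t := fun t ht => by
    rw [hr', IccExtend_of_mem hab _ ht]; rfl
  have hintg : ∀ t ∈ Icc a b, ∫ τ in a..t, r τ = ∫ τ in a..t, r' τ := by
    intro t ht
    refine intervalIntegral.integral_congr fun τ hτ => ?_
    rw [uIcc_of_le ht.1] at hτ
    exact (heq τ ⟨hτ.1, hτ.2.trans ht.2⟩).symm
  have hd : ∀ t, HasDerivAt (fun t => A + K * ∫ τ in a..t, r' τ) (K * r' t) t := fun t =>
    ((intervalIntegral.integral_hasDerivAt_right (hc.intervalIntegrable _ _)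
      (hc.stronglyMeasurableAtFilter _ _) hc.continuousAt).const_mul K).const_add A
  have key := le_gronwallBound_of_liminf_deriv_right_le (f := fun t => A + K * ∫ τ in a..t, r' τ)
    (f' := fun t => K * r' t) (δ := A) (K := K) (ε := 0) (a := a) (b := b)
    (fun t _ => (hd t).continuousAt.continuousWithinAt)
    (fun t _ r hr => (hd t).hasDerivWithinAt.liminf_right_slope_le hr) (by simp)
    (fun t ht => by
      have := h t ⟨ht.1, ht.2.le⟩
      rw [hintg t ⟨ht.1, ht.2.le⟩, ← heq t ⟨ht.1, ht.2.le⟩] at this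
      simpa using mul_le_mul_of_nonneg_left this hK) t ht
  rw [gronwallBound_ε0] at key
  refine (h t ht).trans ?_
  rw [hintg t ht]
  exact key

section
variable {X : Type*} [NormedAddCommGroup X] [NormedSpace ℝ X]

lemma diff_of_est [CompleteSpace X] (Ψ : X → X) (x : X) (B : ℝ) (hB : 0 ≤ B)
    (hlip : ∀ v, ‖Ψ (x + v) - Ψ x‖ ≤ B * ‖v‖)
    (h3 : ∀ (a b c : ℝ) (v₁ v₂ v₃ : X), a • v₁ + b • v₂ + c • v₃ = 0 →
      ‖a • (Ψ (x + v₁) - Ψ x) + b • (Ψ (x + v₂) - Ψ x) + c • (Ψ (x + v₃) - Ψ x)‖ ≤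
        B * (|a| * ‖v₁‖ ^ 2 + |b| * ‖v₂‖ ^ 2 + |c| * ‖v₃‖ ^ 2)) :
    DifferentiableAt ℝ Ψ x := by
  set ψ : X → X := fun v => Ψ (x + v) - Ψ x with hψ
  set e : ℕ → ℝ := fun n => 1 / ((n : ℝ) + 1) with he
  have epos : ∀ n, 0 < e n := fun n => by simp only [he]; positivity
  have elim : Tendsto e atTop (𝓝 0) := tendsto_one_div_add_atTop_nhds_zero_nat
  have eanti : ∀ n m, n ≤ m → e m ≤ e n := fun n m h => by
    simp only [he]; gcongr
  set q : ℕ → X → X := fun n v => (e n)⁻¹ • ψ (e n • v) with hq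
  have hsq : ∀ n (v : X), |(e n)⁻¹| * ‖e n • v‖ ^ 2 = e n * ‖v‖ ^ 2 := fun n v => by
    rw [norm_smul, abs_of_pos (inv_pos.2 (epos n)), Real.norm_eq_abs, abs_of_pos (epos n)]
    have := (epos n).ne'
    field_simp
  have hcan : ∀ n (v : X), (e n)⁻¹ • e n • v = v := fun n v => inv_smul_smul₀ (epos n).ne' v
  have hqlip : ∀ n v, ‖q n v‖ ≤ B * ‖v‖ := fun n v => by
    have := hlip (e n • v)
    simp only [hq, norm_smul, norm_inv, Real.norm_eq_abs, abs_of_pos (epos n)] at this ⊢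
    calc (e n)⁻¹ * ‖ψ (e n • v)‖ ≤ (e n)⁻¹ * (B * (e n * ‖v‖)) := by
          have := (epos n).le
          gcongr
      _ = B * ‖v‖ := by have := (epos n).ne'; field_simp
  have hcau : ∀ v, CauchySeq (fun n => q n v) := fun v => by
    refine cauchySeq_of_le_tendsto_0 (fun n => B * (2 * e n * ‖v‖ ^ 2)) ?_ ?_
    · intro n m N hn hm
      have := h3 (e n)⁻¹ (-(e m)⁻¹) 0 (e n • v) (e m • v) 0 (by
        rw [neg_smul, hcan, hcan]; simp)
      rw [abs_neg, hsq, hsq] at this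
      rw [dist_eq_norm]
      have e1 : q n v - q m v = (e n)⁻¹ • (Ψ (x + e n • v) - Ψ x) +
          (-(e m)⁻¹) • (Ψ (x + e m • v) - Ψ x) + (0 : ℝ) • (Ψ (x + 0) - Ψ x) := by
        simp only [hq, hψ]; module
      rw [e1]
      refine this.trans ?_
      have := eanti _ _ hn
      have := eanti _ _ hm
      have h2 : 0 ≤ ‖v‖ ^ 2 := by positivity
      refine mul_le_mul_of_nonneg_left ?_ hB
      simp only [abs_zero, zero_mul, add_zero]
      nlinarith
    · have := ((elim.const_mul 2).mul_const (‖v‖ ^ 2)).const_mul B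
      simpa using this
  choose A hA using fun v => cauchySeq_tendsto_of_complete (hcau v)
  have hlin : ∀ (a b : ℝ) (v w : X), A (a • v + b • w) = a • A v + b • A w := by
    intro a b v w
    have t1 : Tendsto (fun n => q n (a • v + b • w) - (a • q n v + b • q n w)) atTop
        (𝓝 (A (a • v + b • w) - (a • A v + b • A w))) :=
      (hA _).sub (((hA v).const_smul a).add ((hA w).const_smul b))
    have t2 : Tendsto (fun n => q n (a • v + b • w) - (a • q n v + b • q n w)) atTop (𝓝 0) := by
      refine squeeze_zero_norm (a := fun n =>
        B * (e n * (‖a • v + b • w‖ ^ 2 + |a| * ‖v‖ ^ 2 + |b| * ‖w‖ ^ 2))) ?_ ?_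
      · intro n
        have := h3 (e n)⁻¹ (-(a * (e n)⁻¹)) (-(b * (e n)⁻¹)) (e n • (a • v + b • w)) (e n • v)
          (e n • w) (by
            rw [hcan, neg_smul, neg_smul, mul_smul, mul_smul, hcan, hcan]
            abel)
        rw [abs_neg, abs_neg, abs_mul, abs_mul, mul_assoc |a|, mul_assoc |b|,
          hsq, hsq, hsq] at this
        refine le_trans (le_of_eq ?_) (this.trans (le_of_eq (by ring)))
        congr 1
        simp only [hq, hψ, smul_smul, neg_smul]
        abel
      · have := (elim.mul_const
          (‖a • v + b • w‖ ^ 2 + |a| * ‖v‖ ^ 2 + |b| * ‖w‖ ^ 2)).const_mul B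
        simpa using this
    exact sub_eq_zero.1 (tendsto_nhds_unique t1 t2)
  let A' : X →L[ℝ] X := LinearMap.mkContinuous
    { toFun := A
      map_add' := fun v w => by simpa using hlin 1 1 v w
      map_smul' := fun a v => by simpa using hlin a 0 v 0 } B
    (fun v => le_of_tendsto (hA v).norm (Eventually.of_forall fun n => hqlip n v))
  have hrem : ∀ v, ‖Ψ (x + v) - Ψ x - A' v‖ ≤ 2 * B * ‖v‖ ^ 2 := by
    intro v
    refine le_of_tendsto ((tendsto_const_nhds (x := Ψ (x + v) - Ψ x)).sub (hA v)).norm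
      (Eventually.of_forall fun n => ?_)
    have := h3 1 (-(e n)⁻¹) 0 v (e n • v) 0 (by
        rw [neg_smul, hcan]; simp)
    rw [abs_neg, hsq] at this
    have e1 : Ψ (x + v) - Ψ x - q n v = (1 : ℝ) • (Ψ (x + v) - Ψ x) +
          (-(e n)⁻¹) • (Ψ (x + e n • v) - Ψ x) + (0 : ℝ) • (Ψ (x + 0) - Ψ x) := by
      simp only [hq, hψ]; module
    rw [e1]
    refine this.trans ?_
    have h1 : e n ≤ 1 := by simpa [he] using eanti 0 n (Nat.zero_le n)
    have h2 : 0 ≤ ‖v‖ ^ 2 := by positivity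
    have : |(1:ℝ)| * ‖v‖ ^ 2 + e n * ‖v‖ ^ 2 + |(0:ℝ)| * ‖(0:X)‖ ^ 2 ≤ 2 * ‖v‖ ^ 2 := by
      simp only [abs_one, abs_zero, zero_mul, add_zero]
      nlinarith
    nlinarith [mul_le_mul_of_nonneg_left this hB]
  have : HasFDerivAt Ψ A' x := by
    rw [hasFDerivAt_iff_isLittleO_nhds_zero]
    have h1 : (fun v : X => Ψ (x + v) - Ψ x - A' v) =O[𝓝 0] (fun v : X => ‖v‖ ^ 2) :=
      Asymptotics.IsBigO.of_bound (2 * B) (Eventually.of_forall fun v => by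
        simpa using hrem v)
    exact h1.trans_isLittleO (Asymptotics.isLittleO_norm_pow_id one_lt_two)
  exact this.differentiableAt

end

section
variable {X : Type*} [NormedAddCommGroup X] [NormedSpace ℝ X]

structure SGp (S : ℝ → X →L[ℝ] X) (T C : ℝ) : Prop where
  hC : 0 ≤ C
  zero : S 0 = ContinuousLinearMap.id ℝ X
  add : ∀ a b : ℝ, 0 ≤ a → 0 ≤ b → S (a + b) = (S a).comp (S b)
  cont : ∀ x : X, ContinuousOn (fun σ => S σ x) (Set.Ici (0 : ℝ))
  bound : ∀ σ ∈ Icc (0:ℝ) T, ‖S σ‖ ≤ C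

lemma sgp_exists [CompleteSpace X] (S : ℝ → X →L[ℝ] X) (T : ℝ)
    (hS0 : S 0 = ContinuousLinearMap.id ℝ X)
    (hSadd : ∀ a b : ℝ, 0 ≤ a → 0 ≤ b → S (a + b) = (S a).comp (S b))
    (hScont : ∀ x : X, ContinuousOn (fun σ => S σ x) (Set.Ici (0 : ℝ))) :
    ∃ C, SGp S T C := by
  obtain ⟨C, hC⟩ := banach_steinhaus (g := fun σ : Icc (0:ℝ) T => S σ) (fun x => by
    obtain ⟨C, hC⟩ := isCompact_Icc.exists_bound_of_continuousOn
      ((hScont x).mono (Icc_subset_Ici_self : Icc (0:ℝ) T ⊆ Ici 0))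
    exact ⟨C, fun i => hC i i.2⟩)
  exact ⟨max C 0, le_max_right _ _, hS0, hSadd, hScont,
    fun σ hσ => (hC ⟨σ, hσ⟩).trans (le_max_left _ _)⟩

structure NiceF (T L K : ℝ) (F : ℝ → X → X) : Prop where
  hL : 0 ≤ L
  hK : 0 ≤ K
  meas : ∀ x : X, AEStronglyMeasurable (fun t => F t x) (volume.restrict (Icc (0:ℝ) T))
  ae : ∀ᵐ t ∂(volume.restrict (Icc (0:ℝ) T)),
    (∀ x y : X, ‖F t x - F t y‖ ≤ L * ‖x - y‖) ∧ ‖F t 0‖ ≤ L ∧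
    ∃ D : X → X →L[ℝ] X, (∀ x, ‖D x‖ ≤ L) ∧
      ∀ x y, ‖F t y - F t x - D x (y - x)‖ ≤ K * ‖y - x‖ ^ 2

variable {S : ℝ → X →L[ℝ] X} {T C L K : ℝ} {F : ℝ → X → X}

lemma restrict_le {s t T : ℝ} (hs : 0 ≤ s) (htT : t ≤ T) :
    (volume : Measure ℝ).restrict (Icc s t) ≤ volume.restrict (Icc 0 T) :=
  Measure.restrict_mono (Icc_subset_Icc hs htT) le_rfl

lemma NiceF.growth {t : ℝ} (h1 : ∀ x y : X, ‖F t x - F t y‖ ≤ L * ‖x - y‖) (h2 : ‖F t 0‖ ≤ L)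
    (x : X) : ‖F t x‖ ≤ L * ‖x‖ + L := by
  have := h1 x 0
  rw [sub_zero] at this
  have h3 := norm_sub_norm_le (F t x) (F t 0)
  linarith

lemma conv_aesm (hS : SGp S T C) {s t : ℝ} {h : ℝ → X}
    (hm : AEStronglyMeasurable h (volume.restrict (Icc s t))) :
    AEStronglyMeasurable (fun τ => S (t - τ) (h τ)) (volume.restrict (Icc s t)) := by
  refine aesm_carath (F := fun τ y => S (t - τ) y) (fun x => ?_)
    (Eventually.of_forall fun τ => (S (t - τ)).continuous) hm
  refine ContinuousOn.aestronglyMeasurable ?_ measurableSet_Icc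
  exact (hS.cont x).comp (by fun_prop) (fun τ hτ => by simpa using hτ.2)

lemma conv_int (hS : SGp S T C) {s t B : ℝ} (hs : 0 ≤ s) (hst : s ≤ t) (htT : t ≤ T) {h : ℝ → X}
    (hm : AEStronglyMeasurable h (volume.restrict (Icc s t)))
    (hb : ∀ᵐ τ ∂volume.restrict (Icc s t), ‖h τ‖ ≤ B) :
    IntervalIntegrable (fun τ => S (t - τ) (h τ)) volume s t := by
  rw [intervalIntegrable_iff_integrableOn_Icc_of_le hst]
  refine Integrable.of_bound (conv_aesm hS hm) (C * B) ?_
  filter_upwards [hb, ae_restrict_mem measurableSet_Icc] with τ h1 h2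
  refine (ContinuousLinearMap.le_opNorm _ _).trans ?_
  exact mul_le_mul (hS.bound _ ⟨by linarith [h2.2], by linarith [h2.1]⟩) h1 (norm_nonneg _) hS.hC

lemma NiceF.aesm (hF : NiceF T L K F) {s t : ℝ} (hs : 0 ≤ s) (htT : t ≤ T) {φ : ℝ → X}
    (hφ : ContinuousOn φ (Icc s t)) :
    AEStronglyMeasurable (fun τ => F τ (φ τ)) (volume.restrict (Icc s t)) := by
  refine aesm_carath (F := F) (fun x => (hF.meas x).mono_measure (restrict_le hs htT)) ?_
    (hφ.aestronglyMeasurable measurableSet_Icc)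
  filter_upwards [ae_mono (restrict_le hs htT) hF.ae] with τ hτ
  exact (LipschitzWith.of_dist_le_mul (K := ⟨L, hF.hL⟩) fun x y => by
    rw [dist_eq_norm, dist_eq_norm]; exact hτ.1 x y).continuous

lemma NiceF.int (hS : SGp S T C) (hF : NiceF T L K F) {s t : ℝ} (hs : 0 ≤ s) (hst : s ≤ t)
    (htT : t ≤ T) {φ : ℝ → X} (hφ : ContinuousOn φ (Icc s t)) :
    IntervalIntegrable (fun τ => S (t - τ) (F τ (φ τ))) volume s t := by
  obtain ⟨B, hB⟩ := isCompact_Icc.exists_bound_of_continuousOn hφ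
  refine conv_int hS (B := L * B + L) hs hst htT (hF.aesm hs htT hφ) ?_
  filter_upwards [ae_mono (restrict_le hs htT) hF.ae, ae_restrict_mem measurableSet_Icc]
    with τ hτ hm
  refine (NiceF.growth hτ.1 hτ.2.1 _).trans ?_
  have := mul_le_mul_of_nonneg_left (hB τ hm) hF.hL
  linarith

lemma mild_bound (hS : SGp S T C) {s b c L : ℝ} (hs : 0 ≤ s) (hbT : b ≤ T) (hL : 0 ≤ L)
    (hc : 0 ≤ c) {a : X} {w h : ℝ → X} (hw : ContinuousOn w (Icc s b))
    (heq : ∀ t ∈ Icc s b, w t = S (t - s) a + ∫ τ in s..t, S (t - τ) (h τ))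
    (hh : ∀ᵐ τ ∂volume.restrict (Icc s b), ‖h τ‖ ≤ L * ‖w τ‖ + c) :
    ∀ t ∈ Icc s b, ‖w t‖ ≤ C * (‖a‖ + c * (b - s)) * Real.exp (C * L * T) := by
  intro t ht
  have hC := hS.hC
  have hsb : s ≤ b := ht.1.trans ht.2
  have key := gronwall_int (r := fun t => ‖w t‖) (A := C * (‖a‖ + c * (b - s))) (K := C * L)
    (mul_nonneg hC hL) hw.norm (fun t ht => by
      have hwi : IntervalIntegrable (fun τ => ‖w τ‖) volume s t :=
        (hw.norm.mono (Icc_subset_Icc_right ht.2)).intervalIntegrable_of_Icc ht.1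
      have h1 : ‖S (t - s) a‖ ≤ C * ‖a‖ :=
        (ContinuousLinearMap.le_opNorm _ _).trans (mul_le_mul_of_nonneg_right
          (hS.bound _ ⟨by linarith [ht.1], by linarith [ht.2]⟩) (norm_nonneg _))
      have h2 : ‖∫ τ in s..t, S (t - τ) (h τ)‖ ≤ ∫ τ in s..t, (C * L * ‖w τ‖ + C * c) := by
        refine intervalIntegral.norm_integral_le_of_norm_le ht.1 ?_
          ((hwi.const_mul _).add intervalIntegrable_const)
        rw [← ae_restrict_iff' measurableSet_Ioc]
        have hle : (volume : Measure ℝ).restrict (Ioc s t) ≤ volume.restrict (Icc s b) :=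
          Measure.restrict_mono (Ioc_subset_Icc_self.trans (Icc_subset_Icc_right ht.2)) le_rfl
        filter_upwards [ae_mono hle hh, ae_restrict_mem measurableSet_Ioc] with τ h1 h2
        refine (ContinuousLinearMap.le_opNorm _ _).trans ?_
        refine (mul_le_mul (hS.bound _ ⟨by linarith [h2.2], by linarith [h2.1, ht.2]⟩) h1
          (norm_nonneg _) hC).trans (le_of_eq (by ring))
      rw [intervalIntegral.integral_add (hwi.const_mul _) intervalIntegrable_const,
        intervalIntegral.integral_const_mul, intervalIntegral.integral_const, smul_eq_mul] at h2
      have h3 : (t - s) * (C * c) ≤ (b - s) * (C * c) :=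
        mul_le_mul_of_nonneg_right (by linarith [ht.2]) (mul_nonneg hC hc)
      have h4 := norm_add_le (S (t - s) a) (∫ τ in s..t, S (t - τ) (h τ))
      rw [← heq t ht] at h4
      linarith) t ht
  refine key.trans ?_
  have h5 : 0 ≤ b - s := by linarith
  refine mul_le_mul_of_nonneg_left (Real.exp_le_exp.2 ?_) (by positivity)
  exact mul_le_mul_of_nonneg_left (by linarith [ht.2]) (mul_nonneg hC hL)

lemma mild_init (hS : SGp S T C) {s : ℝ} (hsT : s ≤ T) {x : X} {φ : ℝ → X}
    (hφ : IsMildSol T S F s x φ) : φ s = x := by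
  have := hφ.2 s ⟨le_rfl, hsT⟩
  simpa [hS.zero] using this

lemma mild_shift [CompleteSpace X] (hS : SGp S T C) (hF : NiceF T L K F) {s t : ℝ} (hs : 0 ≤ s)
    (ht : t ∈ Icc s T)
    {x : X} {φ : ℝ → X} (hφ : IsMildSol T S F s x φ) : IsMildSol T S F t (φ t) φ := by
  refine ⟨hφ.1.mono (Icc_subset_Icc_left ht.1), fun r hr => ?_⟩
  have hsr : s ≤ r := ht.1.trans hr.1
  have i1 := hF.int hS hs hsr hr.2 (hφ.1.mono (Icc_subset_Icc_right hr.2))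
  have i2 := hF.int hS hs ht.1 ht.2 (hφ.1.mono (Icc_subset_Icc_right ht.2))
  have ia : IntervalIntegrable (fun τ => S (r - τ) (F τ (φ τ))) volume s t :=
    i1.mono_set (by rw [uIcc_of_le ht.1, uIcc_of_le hsr]; exact Icc_subset_Icc_right hr.1)
  have ib : IntervalIntegrable (fun τ => S (r - τ) (F τ (φ τ))) volume t r :=
    i1.mono_set (by rw [uIcc_of_le hr.1, uIcc_of_le hsr]; exact Icc_subset_Icc_left ht.1)
  rw [hφ.2 r ⟨hsr, hr.2⟩, hφ.2 t ht, ← intervalIntegral.integral_add_adjacent_intervals ia ib,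
    map_add, ← ContinuousLinearMap.intervalIntegral_comp_comm _ i2, ← add_assoc]
  congr 2
  · have := hS.add (r - t) (t - s) (by linarith [hr.1]) (by linarith [ht.1])
    rw [← ContinuousLinearMap.comp_apply, ← this]
    congr 2; ring
  · refine intervalIntegral.integral_congr fun τ hτ => ?_
    rw [uIcc_of_le ht.1] at hτ
    have := hS.add (r - t) (t - τ) (by linarith [hr.1]) (by linarith [hτ.2])
    show _ = S (r - t) (S (t - τ) _)
    rw [← ContinuousLinearMap.comp_apply, ← this]
    congr 2; ring

lemma mild_norm (hS : SGp S T C) (hF : NiceF T L K F) {s : ℝ} (hs : 0 ≤ s)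
    {x : X} {φ : ℝ → X} (hφ : IsMildSol T S F s x φ) :
    ∀ t ∈ Icc s T, ‖φ t‖ ≤ C * (‖x‖ + L * T) * Real.exp (C * L * T) := by
  intro t ht
  have hL := hF.hL
  have hC := hS.hC
  refine (mild_bound hS hs le_rfl hF.hL hF.hL hφ.1 hφ.2 ?_ t ht).trans ?_
  · filter_upwards [ae_mono (restrict_le hs le_rfl) hF.ae] with τ hτ
    exact NiceF.growth hτ.1 hτ.2.1 _
  · gcongr
    linarith

lemma mild_lip (hS : SGp S T C) (hF : NiceF T L K F) {s : ℝ} (hs : 0 ≤ s)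
    {x y : X} {φ ψ : ℝ → X} (hφ : IsMildSol T S F s x φ) (hψ : IsMildSol T S F s y ψ) :
    ∀ t ∈ Icc s T, ‖φ t - ψ t‖ ≤ C * Real.exp (C * L * T) * ‖x - y‖ := by
  intro t ht
  have := mild_bound hS hs le_rfl hF.hL le_rfl (a := x - y) (w := fun t => φ t - ψ t)
    (h := fun τ => F τ (φ τ) - F τ (ψ τ)) (hφ.1.sub hψ.1) (fun t ht => by
      have i1 := hF.int hS hs ht.1 ht.2 (hφ.1.mono (Icc_subset_Icc_right ht.2))
      have i2 := hF.int hS hs ht.1 ht.2 (hψ.1.mono (Icc_subset_Icc_right ht.2))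
      simp only [map_sub]
      rw [hφ.2 t ht, hψ.2 t ht, intervalIntegral.integral_sub i1 i2]
      abel) (by
      filter_upwards [ae_mono (restrict_le hs le_rfl) hF.ae] with τ hτ
      simpa using hτ.1 _ _) t ht
  refine this.trans (le_of_eq (by ring))

lemma mild_unique (hS : SGp S T C) (hF : NiceF T L K F) {s : ℝ} (hs : 0 ≤ s)
    {x : X} {φ ψ : ℝ → X} (hφ : IsMildSol T S F s x φ) (hψ : IsMildSol T S F s x ψ) :
    ∀ t ∈ Icc s T, φ t = ψ t := by
  intro t ht
  have := mild_lip hS hF hs hφ hψ t ht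
  rw [sub_self, norm_zero, mul_zero] at this
  exact sub_eq_zero.1 (norm_le_zero_iff.1 this)

lemma mild_three (hS : SGp S T C) (hF : NiceF T L K F) {s : ℝ} (hs : 0 ≤ s)
    {x v₁ v₂ v₃ : X} {a b c : ℝ} {φ φ₁ φ₂ φ₃ : ℝ → X} (hφ : IsMildSol T S F s x φ)
    (h1 : IsMildSol T S F s (x + v₁) φ₁) (h2 : IsMildSol T S F s (x + v₂) φ₂)
    (h3 : IsMildSol T S F s (x + v₃) φ₃) (h0 : a • v₁ + b • v₂ + c • v₃ = 0) :
    ∀ t ∈ Icc s T, ‖a • (φ₁ t - φ t) + b • (φ₂ t - φ t) + c • (φ₃ t - φ t)‖ ≤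
      C * (K * (C * Real.exp (C * L * T)) ^ 2 * T) * Real.exp (C * L * T) *
        (|a| * ‖v₁‖ ^ 2 + |b| * ‖v₂‖ ^ 2 + |c| * ‖v₃‖ ^ 2) := by
  intro t ht
  have hL := hF.hL
  have hK := hF.hK
  have hC := hS.hC
  set Q := C * Real.exp (C * L * T) with hQ
  have hQ0 : 0 ≤ Q := by positivity
  set N := |a| * ‖v₁‖ ^ 2 + |b| * ‖v₂‖ ^ 2 + |c| * ‖v₃‖ ^ 2 with hN
  have hN0 : 0 ≤ N := by positivity
  have hsT : s ≤ T := ht.1.trans ht.2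
  have l1 := mild_lip hS hF hs h1 hφ
  have l2 := mild_lip hS hF hs h2 hφ
  have l3 := mild_lip hS hF hs h3 hφ
  simp only [add_sub_cancel_left] at l1 l2 l3
  have := mild_bound hS hs le_rfl hF.hL (c := K * Q ^ 2 * N) (by positivity) (a := (0 : X))
    (w := fun t => a • (φ₁ t - φ t) + b • (φ₂ t - φ t) + c • (φ₃ t - φ t))
    (h := fun τ => a • (F τ (φ₁ τ) - F τ (φ τ)) + b • (F τ (φ₂ τ) - F τ (φ τ)) +
      c • (F τ (φ₃ τ) - F τ (φ τ)))
    ((((h1.1.sub hφ.1).const_smul a).add ((h2.1.sub hφ.1).const_smul b)).add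
      ((h3.1.sub hφ.1).const_smul c)) (fun t ht => by
      have i0 := hF.int hS hs ht.1 ht.2 (hφ.1.mono (Icc_subset_Icc_right ht.2))
      have i1 := hF.int hS hs ht.1 ht.2 (h1.1.mono (Icc_subset_Icc_right ht.2))
      have i2 := hF.int hS hs ht.1 ht.2 (h2.1.mono (Icc_subset_Icc_right ht.2))
      have i3 := hF.int hS hs ht.1 ht.2 (h3.1.mono (Icc_subset_Icc_right ht.2))
      simp only [map_sub, map_add, map_smul, map_zero]
      have j1 : IntervalIntegrable
          (fun τ => a • (S (t - τ) (F τ (φ₁ τ)) - S (t - τ) (F τ (φ τ)))) volume s t :=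
        (i1.sub i0).smul a
      have j2 : IntervalIntegrable
          (fun τ => b • (S (t - τ) (F τ (φ₂ τ)) - S (t - τ) (F τ (φ τ)))) volume s t :=
        (i2.sub i0).smul b
      have j3 : IntervalIntegrable
          (fun τ => c • (S (t - τ) (F τ (φ₃ τ)) - S (t - τ) (F τ (φ τ)))) volume s t :=
        (i3.sub i0).smul c
      rw [intervalIntegral.integral_add (j1.add j2) j3, intervalIntegral.integral_add j1 j2, intervalIntegral.integral_smul, intervalIntegral.integral_smul,
        intervalIntegral.integral_smul, intervalIntegral.integral_sub i1 i0,
        intervalIntegral.integral_sub i2 i0, intervalIntegral.integral_sub i3 i0,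
        hφ.2 t ht, h1.2 t ht, h2.2 t ht, h3.2 t ht]
      have := congrArg (S (t - s)) h0
      simp only [map_add, map_smul, map_zero] at this
      rw [← this]
      simp only [map_add]
      module) (by
      filter_upwards [ae_mono (restrict_le hs le_rfl) hF.ae, ae_restrict_mem measurableSet_Icc]
        with τ hτ hm
      obtain ⟨-, -, D, hD, hR⟩ := hτ
      have r : ∀ (a : ℝ) (y v : X), ‖y - φ τ‖ ≤ Q * ‖v‖ →
          ‖a • (F τ y - F τ (φ τ) - D (φ τ) (y - φ τ))‖ ≤ K * Q ^ 2 * (|a| * ‖v‖ ^ 2) := by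
        intro a y v hy
        rw [norm_smul, Real.norm_eq_abs]
        calc _ ≤ |a| * (K * (Q * ‖v‖) ^ 2) := by
              refine mul_le_mul_of_nonneg_left ((hR _ _).trans ?_) (abs_nonneg _)
              gcongr
          _ = _ := by ring
      have e : a • (F τ (φ₁ τ) - F τ (φ τ)) + b • (F τ (φ₂ τ) - F τ (φ τ)) +
          c • (F τ (φ₃ τ) - F τ (φ τ)) =
          D (φ τ) (a • (φ₁ τ - φ τ) + b • (φ₂ τ - φ τ) + c • (φ₃ τ - φ τ)) +
          (a • (F τ (φ₁ τ) - F τ (φ τ) - D (φ τ) (φ₁ τ - φ τ)) +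
          b • (F τ (φ₂ τ) - F τ (φ τ) - D (φ τ) (φ₂ τ - φ τ)) +
          c • (F τ (φ₃ τ) - F τ (φ τ) - D (φ τ) (φ₃ τ - φ τ))) := by
        simp only [map_add, map_smul]
        module
      rw [e]
      refine (norm_add_le _ _).trans (add_le_add ?_ ?_)
      · exact (ContinuousLinearMap.le_opNorm _ _).trans
          (mul_le_mul_of_nonneg_right (hD _) (norm_nonneg _))
      · refine (norm_add₃_le).trans ?_
        have := r a _ _ (l1 τ hm)
        have := r b _ _ (l2 τ hm)
        have := r c _ _ (l3 τ hm)
        rw [hN]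
        linarith) t ht
  refine this.trans ?_
  rw [norm_zero, zero_add]
  calc C * (K * Q ^ 2 * N * (T - s)) * Real.exp (C * L * T)
      ≤ C * (K * Q ^ 2 * N * T) * Real.exp (C * L * T) := by gcongr; linarith
    _ = _ := by ring

lemma flow_diff [CompleteSpace X] (hS : SGp S T C) (hF : NiceF T L K F) {s : ℝ} (hs : 0 ≤ s)
    (hsT : s ≤ T) {Φ : ℝ → X → X} (hΦ : ∀ x, IsMildSol T S F s x (fun t => Φ t x)) (x : X) :
    DifferentiableAt ℝ (Φ T) x := by
  have hL := hF.hL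
  have hK := hF.hK
  have hC := hS.hC
  have hT : 0 ≤ T := hs.trans hsT
  set Q := C * Real.exp (C * L * T) with hQ
  have hQ0 : 0 ≤ Q := by positivity
  set P := C * (K * Q ^ 2 * T) * Real.exp (C * L * T) with hP
  have hP0 : 0 ≤ P := by positivity
  refine diff_of_est (Φ T) x (Q + P) (by positivity) (fun v => ?_)
    (fun a b c v₁ v₂ v₃ h => ?_)
  · have := mild_lip hS hF hs (hΦ (x + v)) (hΦ x) T ⟨hsT, le_rfl⟩
    rw [add_sub_cancel_left] at this
    refine this.trans ?_
    gcongr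
    linarith
  · refine (mild_three hS hF hs (hΦ x) (hΦ (x + v₁)) (hΦ (x + v₂)) (hΦ (x + v₃)) h T
      ⟨hsT, le_rfl⟩).trans ?_
    gcongr
    linarith

end

section
variable {X : Type*} [NormedAddCommGroup X] [NormedSpace ℝ X]

lemma taylor_le {Y : Type*} [NormedAddCommGroup Y] [NormedSpace ℝ Y] {g : X → Y} {M : ℝ}
    (hM : 0 ≤ M) (hg : ContDiff ℝ 1 g)
    (hl : ∀ x y : X, ‖fderiv ℝ g x - fderiv ℝ g y‖ ≤ M * ‖x - y‖) (x y : X) :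
    ‖g y - g x - fderiv ℝ g x (y - x)‖ ≤ M * ‖y - x‖ ^ 2 := by
  have := (convex_closedBall x ‖y - x‖).norm_image_sub_le_of_norm_fderiv_le' (𝕜 := ℝ)
    (f := g) (C := M * ‖y - x‖) (φ := fderiv ℝ g x) (x := x) (y := y)
    (fun z _ => hg.differentiable one_ne_zero z)
    (fun z hz => (hl z x).trans (mul_le_mul_of_nonneg_left (by
      simpa [dist_eq_norm] using hz) hM)) (by simp) (by simp [dist_eq_norm])
  refine this.trans (le_of_eq (by ring))

lemma nice_of {m : ℕ} {T : ℝ} {f : ℝ → X → X} {G : ℝ → X → EuclideanSpace ℝ (Fin m) →L[ℝ] X}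
    {Mf MG : ℝ} (hMf : 0 ≤ Mf) (hMG : 0 ≤ MG)
    (hfmeas : ∀ x : X,
      AEStronglyMeasurable (fun t => f t x) (volume.restrict (Set.Icc (0:ℝ) T)))
    (hGmeas : ∀ x : X,
      AEStronglyMeasurable (fun t => G t x) (volume.restrict (Set.Icc (0:ℝ) T)))
    (hA : ∀ᵐ t ∂(volume.restrict (Set.Icc (0:ℝ) T)),
        (∀ x y : X, ‖f t x - f t y‖ ≤ Mf * ‖x - y‖) ∧
        (∀ x y : X, ‖G t x - G t y‖ ≤ MG * ‖x - y‖) ∧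
        ‖f t 0‖ ≤ Mf ∧ ‖G t 0‖ ≤ MG)
    {M : ℝ} (hM : 0 ≤ M)
    (hAplus : ∀ᵐ t ∂(volume.restrict (Set.Icc (0:ℝ) T)),
        ContDiff ℝ 1 (f t) ∧ ContDiff ℝ 1 (G t) ∧
        (∀ x : X, ‖fderiv ℝ (f t) x‖ ≤ M) ∧
        (∀ x : X, ‖fderiv ℝ (G t) x‖ ≤ M) ∧
        (∀ x y : X, ‖fderiv ℝ (f t) x - fderiv ℝ (f t) y‖ ≤ M * ‖x - y‖) ∧
        (∀ x y : X, ‖fderiv ℝ (G t) x - fderiv ℝ (G t) y‖ ≤ M * ‖x - y‖))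
    {v : ℝ → EuclideanSpace ℝ (Fin m)} {R : ℝ} (hR : 0 ≤ R)
    (hv : AEStronglyMeasurable v (volume.restrict (Set.Icc (0:ℝ) T)))
    (hvR : ∀ᵐ t ∂(volume.restrict (Set.Icc (0:ℝ) T)), ‖v t‖ ≤ R) :
    NiceF T ((Mf + M) + (MG + M) * R) (M + M * R) (fun τ y => f τ y + G τ y (v τ)) := by
  refine ⟨by positivity, by positivity, fun x => (hfmeas x).add ?_, ?_⟩
  · exact isBoundedBilinearMap_apply.continuous.comp_aestronglyMeasurable ((hGmeas x).prodMk hv)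
  · filter_upwards [hA, hAplus, hvR] with t ⟨h1, h2, h3, h4⟩ ⟨c1, c2, b1, b2, l1, l2⟩ hvt
    have happ : ∀ (N : ℝ) (A : EuclideanSpace ℝ (Fin m) →L[ℝ] X), ‖A‖ ≤ N →
        ‖A (v t)‖ ≤ N * R := fun N A hA =>
      (A.le_opNorm _).trans (mul_le_mul hA hvt (norm_nonneg _) ((norm_nonneg _).trans hA))
    refine ⟨fun x y => ?_, ?_, fun x => fderiv ℝ (f t) x + (fderiv ℝ (G t) x).flip (v t),
      fun x => ?_, fun x y => ?_⟩
    · have e : f t x + G t x (v t) - (f t y + G t y (v t)) =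
          (f t x - f t y) + (G t x - G t y) (v t) := by
        simp only [ContinuousLinearMap.sub_apply]; abel
      rw [e]
      refine (norm_add_le _ _).trans ((add_le_add (h1 x y) (happ _ _ (h2 x y))).trans ?_)
      have : 0 ≤ (M + M * R) * ‖x - y‖ := by positivity
      nlinarith
    · refine (norm_add_le _ _).trans ((add_le_add h3 (happ _ _ h4)).trans ?_)
      have : 0 ≤ M + M * R := by positivity
      nlinarith
    · refine (norm_add_le _ _).trans ((add_le_add (b1 x) (d := M * R) ?_).trans ?_)
      · refine (ContinuousLinearMap.le_opNorm _ _).trans ?_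
        rw [ContinuousLinearMap.opNorm_flip]
        exact mul_le_mul (b2 x) hvt (norm_nonneg _) hM
      · have : 0 ≤ MG * R := by positivity
        nlinarith
    · have e : f t y + G t y (v t) - (f t x + G t x (v t)) -
          (fderiv ℝ (f t) x + (fderiv ℝ (G t) x).flip (v t)) (y - x) =
          (f t y - f t x - fderiv ℝ (f t) x (y - x)) +
          (G t y - G t x - fderiv ℝ (G t) x (y - x)) (v t) := by
        simp only [ContinuousLinearMap.sub_apply, ContinuousLinearMap.add_apply,
          ContinuousLinearMap.flip_apply]
        abel
      rw [e]
      refine (norm_add_le _ _).trans ((add_le_add (taylor_le hM c1 l1 x y)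
        (happ _ _ (taylor_le hM c2 l2 x y))).trans (le_of_eq (by ring)))

variable {S : ℝ → X →L[ℝ] X} {T C L K L' K' : ℝ} {F Fu : ℝ → X → X}

lemma leb_conv [CompleteSpace X] (hS : SGp S T C) {W : ℝ → X} {B : ℝ}
    (hWm : AEStronglyMeasurable W (volume.restrict (Icc (0:ℝ) T)))
    (hWb : ∀ᵐ t ∂(volume.restrict (Icc (0:ℝ) T)), ‖W t‖ ≤ B) :
    ∀ᵐ t ∂(volume.restrict (Icc (0:ℝ) T)), ∀ ε > 0, ∀ᶠ k in 𝓝[<] (0:ℝ),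
      ‖(∫ τ in (t + k)..t, S (t - τ) (W τ)) - (-k) • W t‖ ≤ ε * (-k) := by
  have hC := hS.hC
  set V : ℝ → X := (Icc (0:ℝ) T).indicator W with hV
  have hVi : Integrable V volume :=
    (integrable_indicator_iff measurableSet_Icc).2 (Integrable.of_bound hWm B hWb)
  have hVW : ∀ t ∈ Icc (0:ℝ) T, V t = W t := fun t ht => indicator_of_mem ht _
  filter_upwards [ae_restrict_of_ae
    (IsUnifLocDoublingMeasure.ae_tendsto_average_norm_sub volume hVi.locallyIntegrable 1),
    ae_restrict_mem measurableSet_Icc, ae_restrict_of_ae (Measure.ae_ne volume (0:ℝ))]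
    with t ht htm ht0 ε hε
  have ht0' : 0 < t := lt_of_le_of_ne htm.1 (Ne.symm ht0)
  have hδ : Tendsto (fun k : ℝ => -k / 2) (𝓝[<] 0) (𝓝[>] 0) := by
    refine tendsto_nhdsWithin_iff.2 ⟨?_, ?_⟩
    · have : Tendsto (fun k : ℝ => -k / 2) (𝓝 0) (𝓝 (-0 / 2)) :=
        (by fun_prop : Continuous fun k : ℝ => -k / 2).tendsto 0
      rw [neg_zero, zero_div] at this
      exact this.mono_left nhdsWithin_le_nhds
    · filter_upwards [self_mem_nhdsWithin] with k hk
      have : k < 0 := hk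
      show 0 < -k / 2
      linarith
  have hav := ht (fun k : ℝ => t + k / 2) (fun k => -k / 2) hδ (by
    filter_upwards [self_mem_nhdsWithin] with k hk
    have : k < 0 := hk
    rw [Real.closedBall_eq_Icc]
    constructor <;> linarith)
  set η := ε / (2 * (C + 1)) with hη
  have hηpos : 0 < η := by positivity
  have hSc : ∀ᶠ σ in 𝓝[≥] (0:ℝ), ‖S σ (W t) - W t‖ < ε / 2 := by
    have h1 : Tendsto (fun σ => ‖S σ (W t) - W t‖) (𝓝[≥] (0:ℝ)) (𝓝 0) := by
      have := ((hS.cont (W t)) 0 (by simp)).tendsto.sub_const (W t) |>.norm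
      simpa [hS.zero] using this
    exact h1.eventually (gt_mem_nhds (by positivity))
  obtain ⟨r, hr, hrs⟩ := mem_nhdsGE_iff_exists_Icc_subset.1 hSc
  have hr0 : (0:ℝ) < r := hr
  have hk1 : ∀ᶠ k in 𝓝[<] (0:ℝ), max (-t) (-r) < k :=
    nhdsWithin_le_nhds (lt_mem_nhds (max_lt (by linarith) (by linarith)))
  filter_upwards [hav.eventually (gt_mem_nhds hηpos), hk1, self_mem_nhdsWithin]
    with k hk hkt hk0
  have hk0 : k < 0 := hk0
  have hkt1 : -t < k := (le_max_left _ _).trans_lt hkt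
  have hkr : -r < k := (le_max_right _ _).trans_lt hkt
  have htk : t + k ≤ t := by linarith
  have hb : Metric.closedBall (t + k / 2) (-k / 2) = Icc (t + k) t := by
    rw [Real.closedBall_eq_Icc]
    congr 1 <;> ring
  rw [hb, setAverage_eq, smul_eq_mul, Real.volume_real_Icc_of_le htk] at hk
  have hk2 : ∫ τ in (t + k)..t, ‖V τ - V t‖ ≤ η * (-k) := by
    rw [intervalIntegral.integral_of_le htk, ← integral_Icc_eq_integral_Ioc]
    rw [show t - (t + k) = -k by ring, inv_mul_lt_iff₀ (by linarith)] at hk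
    linarith
  have hsub : Icc (t + k) t ⊆ Icc 0 T := Icc_subset_Icc (by linarith) htm.2
  have i1 : IntervalIntegrable (fun τ => S (t - τ) (W τ)) volume (t + k) t :=
    conv_int hS (by linarith) htk htm.2
      (hWm.mono_measure (restrict_le (by linarith) htm.2))
      (ae_mono (restrict_le (by linarith) htm.2) hWb)
  have e : (∫ τ in (t + k)..t, S (t - τ) (W τ)) - (-k) • W t =
      ∫ τ in (t + k)..t, (S (t - τ) (W τ) - W t) := by
    rw [intervalIntegral.integral_sub i1 intervalIntegrable_const,
      intervalIntegral.integral_const]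
    congr 2; ring
  have iV : IntervalIntegrable (fun τ => ‖V τ - V t‖) volume (t + k) t :=
    (hVi.intervalIntegrable.sub intervalIntegrable_const).norm
  rw [e]
  have h2 : ‖∫ τ in (t + k)..t, (S (t - τ) (W τ) - W t)‖ ≤
      ∫ τ in (t + k)..t, (C * ‖V τ - V t‖ + ε / 2) := by
    refine intervalIntegral.norm_integral_le_of_norm_le htk (Eventually.of_forall fun τ hτ => ?_)
      ((iV.const_mul _).add intervalIntegrable_const)
    have hτ' : τ ∈ Icc (t + k) t := Ioc_subset_Icc_self hτ
    rw [hVW τ (hsub hτ'), hVW t htm]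
    have e2 : S (t - τ) (W τ) - W t = S (t - τ) (W τ - W t) + (S (t - τ) (W t) - W t) := by
      rw [map_sub]; abel
    rw [e2]
    refine (norm_add_le _ _).trans (add_le_add ?_ ?_)
    · refine (ContinuousLinearMap.le_opNorm _ _).trans
        (mul_le_mul_of_nonneg_right (hS.bound _ ⟨?_, ?_⟩) (norm_nonneg _))
      · linarith [hτ'.2]
      · linarith [(hsub hτ').1, htm.2]
    · have : ‖S (t - τ) (W t) - W t‖ < ε / 2 :=
        hrs ⟨by linarith [hτ'.2], by linarith [hτ'.1]⟩
      exact this.le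
  rw [intervalIntegral.integral_add (iV.const_mul _) intervalIntegrable_const,
    intervalIntegral.integral_const_mul, intervalIntegral.integral_const, smul_eq_mul,
    show t - (t + k) = -k by ring] at h2
  have h3 : C * η ≤ ε / 2 := by
    rw [hη, mul_div_assoc', div_le_div_iff₀ (by positivity) (by positivity)]
    nlinarith
  have h4 := mul_le_mul_of_nonneg_left hk2 hC
  have h5 := mul_le_mul_of_nonneg_right h3 (by linarith : 0 ≤ -k)
  nlinarith

/-- Deviation of a trajectory of `Fu` from the flow of `F`. -/
lemma dev_bound [CompleteSpace X] (hS : SGp S T C) (hF : NiceF T L K F) (hFu : NiceF T L' K' Fu)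
    {B : ℝ} (hB : 0 ≤ B) {x₀ : X} {xu : ℝ → X} (hxu : IsMildSol T S Fu 0 x₀ xu)
    (hWb : ∀ᵐ t ∂(volume.restrict (Icc (0:ℝ) T)), ‖Fu t (xu t) - F t (xu t)‖ ≤ B)
    {s t : ℝ} (hs : 0 ≤ s) (hst : s ≤ t) (htT : t ≤ T) {ψ : ℝ → X}
    (hψ : IsMildSol T S F s (xu s) ψ) :
    ‖xu t - ψ t‖ ≤ C * B * Real.exp (C * L * T) * (t - s) ∧
    ‖(xu t - ψ t) - ∫ τ in s..t, S (t - τ) (Fu τ (xu τ) - F τ (xu τ))‖ ≤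
      C * L * (C * B * Real.exp (C * L * T)) * (t - s) ^ 2 := by
  have hC := hS.hC
  have hL := hF.hL
  have hx := mild_shift hS hFu le_rfl (t := s) ⟨hs, hst.trans htT⟩ hxu
  have hall := mild_bound hS hs htT hL hB (a := (0:X)) (w := fun t => xu t - ψ t)
    (h := fun τ => Fu τ (xu τ) - F τ (ψ τ))
    ((hx.1.sub hψ.1).mono (Icc_subset_Icc_right htT)) (fun r hr => by
      have hrT := hr.2.trans htT
      have i1 := hFu.int hS hs hr.1 hrT (hx.1.mono (Icc_subset_Icc_right hrT))
      have i2 := hF.int hS hs hr.1 hrT (hψ.1.mono (Icc_subset_Icc_right hrT))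
      simp only [map_sub, map_zero]
      rw [intervalIntegral.integral_sub i1 i2, hx.2 r ⟨hr.1, hrT⟩, hψ.2 r ⟨hr.1, hrT⟩]
      abel) (by
      filter_upwards [ae_mono (restrict_le hs htT) hF.ae, ae_mono (restrict_le hs htT) hWb]
        with τ h1 h2
      have e : Fu τ (xu τ) - F τ (ψ τ) = (F τ (xu τ) - F τ (ψ τ)) + (Fu τ (xu τ) - F τ (xu τ)) := by
        abel
      rw [e]
      exact (norm_add_le _ _).trans (add_le_add (h1.1 _ _) h2))
  simp only [norm_zero, zero_add] at hall
  refine ⟨(hall t ⟨hst, le_rfl⟩).trans (le_of_eq (by ring)), ?_⟩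
  have i1 := hFu.int hS hs hst htT (hx.1.mono (Icc_subset_Icc_right htT))
  have i2 := hF.int hS hs hst htT (hψ.1.mono (Icc_subset_Icc_right htT))
  have i3 := hF.int hS hs hst htT (hx.1.mono (Icc_subset_Icc_right htT))
  have e : (xu t - ψ t) - ∫ τ in s..t, S (t - τ) (Fu τ (xu τ) - F τ (xu τ)) =
      ∫ τ in s..t, S (t - τ) (F τ (xu τ) - F τ (ψ τ)) := by
    simp only [map_sub]
    rw [intervalIntegral.integral_sub i1 i3, intervalIntegral.integral_sub i3 i2,
      hx.2 t ⟨hst, htT⟩, hψ.2 t ⟨hst, htT⟩]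
    abel
  rw [e]
  have := intervalIntegral.norm_integral_le_of_norm_le (μ := volume) (a := s) (b := t)
    (f := fun τ => S (t - τ) (F τ (xu τ) - F τ (ψ τ)))
    (g := fun _ => C * (L * (C * (B * (t - s)) * Real.exp (C * L * T)))) hst (by
      rw [← ae_restrict_iff' measurableSet_Ioc]
      have hle : (volume : Measure ℝ).restrict (Ioc s t) ≤ volume.restrict (Icc s t) :=
        Measure.restrict_mono Ioc_subset_Icc_self le_rfl
      filter_upwards [ae_mono (hle.trans (restrict_le hs htT)) hF.ae,
        ae_restrict_mem measurableSet_Ioc] with τ h1 h2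
      refine (ContinuousLinearMap.le_opNorm _ _).trans ?_
      refine mul_le_mul (hS.bound _ ⟨by linarith [h2.2], by linarith [h2.1]⟩) ?_
          (norm_nonneg _) hC
      exact (h1.1 _ _).trans (mul_le_mul_of_nonneg_left (hall τ (Ioc_subset_Icc_self h2)) hL))
    intervalIntegrable_const
  rw [intervalIntegral.integral_const, smul_eq_mul] at this
  exact this.trans (le_of_eq (by ring))

end
/-- monotone descent. If for a.e. `t ∈ I` the control value `u(t)`
satisfies `H̄_t(x^u_t, u(t)) ≤ H̄_t(x^u_t, ū(t))`, where
`H̄_t(x, v) = (α/2)‖v‖² + Dp̄_t(x)[G_t(x) v]`, then `𝓘[u] ≤ 𝓘[ū]`. -/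
theorem monotone_descent
    {X : Type*} [NormedAddCommGroup X] [NormedSpace ℝ X] [CompleteSpace X]
    {m : ℕ} {T : ℝ} (hT : 0 < T)
    (S : ℝ → X →L[ℝ] X)
    (hS0 : S 0 = ContinuousLinearMap.id ℝ X)
    (hSadd : ∀ a b : ℝ, 0 ≤ a → 0 ≤ b → S (a + b) = (S a).comp (S b))
    (hScont : ∀ x : X, ContinuousOn (fun σ => S σ x) (Set.Ici (0 : ℝ)))
    (U : Set (EuclideanSpace ℝ (Fin m))) (hUcpt : IsCompact U) (hUcvx : Convex ℝ U)
    (f : ℝ → X → X) (G : ℝ → X → EuclideanSpace ℝ (Fin m) →L[ℝ] X)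
    {Mf MG : ℝ} (hMf : 0 ≤ Mf) (hMG : 0 ≤ MG)
    (hfmeas : ∀ x : X,
      AEStronglyMeasurable (fun t => f t x) (volume.restrict (Set.Icc (0:ℝ) T)))
    (hGmeas : ∀ x : X,
      AEStronglyMeasurable (fun t => G t x) (volume.restrict (Set.Icc (0:ℝ) T)))
    (hA : ∀ᵐ t ∂(volume.restrict (Set.Icc (0:ℝ) T)),
        (∀ x y : X, ‖f t x - f t y‖ ≤ Mf * ‖x - y‖) ∧
        (∀ x y : X, ‖G t x - G t y‖ ≤ MG * ‖x - y‖) ∧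
        ‖f t 0‖ ≤ Mf ∧ ‖G t 0‖ ≤ MG)
    {M : ℝ} (hM : 0 ≤ M)
    (hDfmeas : ∀ x : X,
      AEStronglyMeasurable (fun t => fderiv ℝ (f t) x) (volume.restrict (Set.Icc (0:ℝ) T)))
    (hDGmeas : ∀ x : X,
      AEStronglyMeasurable (fun t => fderiv ℝ (G t) x) (volume.restrict (Set.Icc (0:ℝ) T)))
    (hAplus : ∀ᵐ t ∂(volume.restrict (Set.Icc (0:ℝ) T)),
        ContDiff ℝ 1 (f t) ∧ ContDiff ℝ 1 (G t) ∧
        (∀ x : X, ‖fderiv ℝ (f t) x‖ ≤ M) ∧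
        (∀ x : X, ‖fderiv ℝ (G t) x‖ ≤ M) ∧
        (∀ x y : X, ‖fderiv ℝ (f t) x - fderiv ℝ (f t) y‖ ≤ M * ‖x - y‖) ∧
        (∀ x y : X, ‖fderiv ℝ (G t) x - fderiv ℝ (G t) y‖ ≤ M * ‖x - y‖))
    (ubar : ℝ → EuclideanSpace ℝ (Fin m))
    (hubar_meas : AEStronglyMeasurable ubar (volume.restrict (Set.Icc (0:ℝ) T)))
    (hubar_mem : ∀ᵐ t ∂(volume.restrict (Set.Icc (0:ℝ) T)), ubar t ∈ U)
    (Φ : ℝ → ℝ → X → X)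
    (hΦ : ∀ s ∈ Set.Icc (0:ℝ) T, ∀ x : X,
      IsMildSol T S (fun τ y => f τ y + G τ y (ubar τ)) s x (fun t => Φ s t x))
    (ℓ : X → ℝ) (hℓ : ContDiff ℝ 1 ℓ)
    (hℓLip : ∀ B : Set X, Bornology.IsBounded B →
      ∃ K : ℝ, ∀ x ∈ B, ∀ y ∈ B, |ℓ x - ℓ y| ≤ K * ‖x - y‖)
    (u : ℝ → EuclideanSpace ℝ (Fin m))
    (hu_meas : AEStronglyMeasurable u (volume.restrict (Set.Icc (0:ℝ) T)))
    (hu_mem : ∀ᵐ t ∂(volume.restrict (Set.Icc (0:ℝ) T)), u t ∈ U)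
    (x₀ : X) (xu : ℝ → X)
    (hxu : IsMildSol T S (fun τ y => f τ y + G τ y (u τ)) 0 x₀ xu)
    (α : ℝ) (hα : 0 ≤ α)
    (hH : ∀ᵐ t ∂(volume.restrict (Set.Icc (0:ℝ) T)),
      α / 2 * ‖u t‖ ^ 2 +
          fderiv ℝ (fun y => ℓ (Φ t T y)) (xu t) (G t (xu t) (u t)) ≤
        α / 2 * ‖ubar t‖ ^ 2 +
          fderiv ℝ (fun y => ℓ (Φ t T y)) (xu t) (G t (xu t) (ubar t))) :
    ℓ (xu T) + α / 2 * ∫ t in Set.Icc (0:ℝ) T, ‖u t‖ ^ 2 ≤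
      ℓ (Φ 0 T x₀) + α / 2 * ∫ t in Set.Icc (0:ℝ) T, ‖ubar t‖ ^ 2 := by
  obtain ⟨C, hS⟩ := sgp_exists S T hS0 hSadd hScont
  obtain ⟨R₀, hR₀⟩ := hUcpt.isBounded.exists_norm_le
  set R := max R₀ 0 with hRdef
  have hR : 0 ≤ R := le_max_right _ _
  have hUR : ∀ v ∈ U, ‖v‖ ≤ R := fun v hv => (hR₀ v hv).trans (le_max_left _ _)
  have hub : ∀ᵐ t ∂(volume.restrict (Set.Icc (0:ℝ) T)), ‖u t‖ ≤ R :=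
    hu_mem.mono fun t ht => hUR _ ht
  have hubb : ∀ᵐ t ∂(volume.restrict (Set.Icc (0:ℝ) T)), ‖ubar t‖ ≤ R :=
    hubar_mem.mono fun t ht => hUR _ ht
  set F : ℝ → X → X := fun τ y => f τ y + G τ y (ubar τ) with hFdef
  set Fu : ℝ → X → X := fun τ y => f τ y + G τ y (u τ) with hFudef
  have hF := nice_of hMf hMG hfmeas hGmeas hA hM hAplus hR hubar_meas hubb
  have hFu := nice_of hMf hMG hfmeas hGmeas hA hM hAplus hR hu_meas hub
  rw [← hFdef] at hF
  rw [← hFudef] at hFu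
  set L := (Mf + M) + (MG + M) * R with hLdef
  set K := M + M * R with hKdef
  have hL := hF.hL
  have hC := hS.hC
  obtain ⟨Rx, hRx⟩ := isCompact_Icc.exists_bound_of_continuousOn hxu.1
  have hRx0 : 0 ≤ Rx := (norm_nonneg _).trans (hRx 0 ⟨le_rfl, hT.le⟩)
  set B := 2 * (L * Rx + L) with hBdef
  have hB : 0 ≤ B := by positivity
  have hWb : ∀ᵐ t ∂(volume.restrict (Icc (0:ℝ) T)), ‖Fu t (xu t) - F t (xu t)‖ ≤ B := by
    filter_upwards [hF.ae, hFu.ae, ae_restrict_mem measurableSet_Icc] with t h1 h2 ht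
    have a1 := NiceF.growth h1.1 h1.2.1 (xu t)
    have a2 := NiceF.growth h2.1 h2.2.1 (xu t)
    have a3 := mul_le_mul_of_nonneg_left (hRx t ht) hL
    have := norm_sub_le (Fu t (xu t)) (F t (xu t))
    linarith
  have hWm : AEStronglyMeasurable (fun t => Fu t (xu t) - F t (xu t))
      (volume.restrict (Icc (0:ℝ) T)) :=
    (hFu.aesm le_rfl le_rfl hxu.1).sub (hF.aesm le_rfl le_rfl hxu.1)
  have hflow : ∀ s t, 0 ≤ s → s ≤ t → t ≤ T → ∀ x, Φ t T (Φ s t x) = Φ s T x := by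
    intro s t hs hst htT x
    have h1 := hΦ s ⟨hs, hst.trans htT⟩ x
    have h2 := mild_shift hS hF hs (t := t) ⟨hst, htT⟩ h1
    exact mild_unique hS hF (hs.trans hst) (hΦ t ⟨hs.trans hst, htT⟩ _) h2 T ⟨htT, le_rfl⟩
  set g : ℝ → ℝ := fun t => ℓ (Φ t T (xu t)) with hg
  set E := Real.exp (C * L * T) with hE
  have hE0 : 0 ≤ E := (Real.exp_pos _).le
  have hdev := fun s t (hs : 0 ≤ s) (hst : s ≤ t) (htT : t ≤ T) =>
    dev_bound hS hF hFu hB hxu hWb hs hst htT (hΦ s ⟨hs, hst.trans htT⟩ (xu s))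
  -- `g` is Lipschitz
  obtain ⟨K₀, hK₀⟩ := hℓLip (Metric.closedBall 0 (C * (Rx + L * T) * E)) Metric.isBounded_closedBall
  have hgl1 : ∀ s t, 0 ≤ s → s ≤ t → t ≤ T →
      |g t - g s| ≤ (max K₀ 0 * (C * E * (C * B * E))) * |t - s| := by
    intro s t hs hst htT
    have hmem : ∀ r ∈ Icc 0 T, Φ r T (xu r) ∈ Metric.closedBall (0:X) (C * (Rx + L * T) * E) := by
      intro r hr
      rw [mem_closedBall_zero_iff]
      refine (mild_norm hS hF hr.1 (hΦ r hr (xu r)) T ⟨hr.2, le_rfl⟩).trans ?_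
      have := hRx r hr
      gcongr
    have ht : t ∈ Icc 0 T := ⟨hs.trans hst, htT⟩
    have h1 := hK₀ _ (hmem t ht) _ (hmem s ⟨hs, hst.trans htT⟩)
    have h2 := mild_lip hS hF ht.1 (hΦ t ht (xu t)) (hΦ t ht (Φ s t (xu s))) T ⟨htT, le_rfl⟩
    simp only [hflow s t hs hst htT] at h2
    have h3 := (hdev s t hs hst htT).1
    rw [abs_of_nonneg (by linarith : 0 ≤ t - s)]
    calc |g t - g s| ≤ max K₀ 0 * ‖Φ t T (xu t) - Φ s T (xu s)‖ :=
          h1.trans (mul_le_mul_of_nonneg_right (le_max_left _ _) (norm_nonneg _))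
      _ ≤ max K₀ 0 * (C * E * (C * B * E * (t - s))) := by
          refine mul_le_mul_of_nonneg_left (h2.trans ?_) (le_max_right _ _)
          exact mul_le_mul_of_nonneg_left h3 (by positivity)
      _ = _ := by ring
  have hac : AbsolutelyContinuousOnInterval g 0 T := by
    refine LipschitzOnWith.absolutelyContinuousOnInterval
      (K := (max K₀ 0 * (C * E * (C * B * E))).toNNReal) ?_
    rw [uIcc_of_le hT.le]
    refine LipschitzOnWith.of_dist_le_mul fun s hs t ht => ?_
    rw [Real.coe_toNNReal _ (mul_nonneg (le_max_right _ _) (by positivity)), Real.dist_eq,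
      Real.dist_eq]
    rcases le_total s t with h | h
    · rw [abs_sub_comm (g s), abs_sub_comm s]
      exact hgl1 s t hs.1 h ht.2
    · exact hgl1 t s ht.1 h hs.2
  -- derivative of `g`
  have hder : ∀ᵐ t ∂(volume.restrict (Icc (0:ℝ) T)), deriv g t =
      fderiv ℝ (fun y => ℓ (Φ t T y)) (xu t) (Fu t (xu t) - F t (xu t)) := by
    have hdiff := hac.ae_differentiableAt
    rw [uIcc_of_le hT.le] at hdiff
    filter_upwards [leb_conv hS hWm hWb, ae_restrict_mem measurableSet_Icc,
      (ae_restrict_iff' measurableSet_Icc).2 hdiff,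
      ae_restrict_of_ae (Measure.ae_ne volume (0:ℝ))] with t hleb ht hd ht0
    have ht0' : 0 < t := lt_of_le_of_ne ht.1 (Ne.symm ht0)
    have h1 := hd.hasDerivAt.tendsto_slope_zero_left
    have hp : DifferentiableAt ℝ (fun y => ℓ (Φ t T y)) (xu t) :=
      (hℓ.differentiable one_ne_zero _).comp (xu t)
        (flow_diff hS hF ht.1 ht.2 (fun x => hΦ t ht x) (xu t))
    have hkt : ∀ᶠ k in 𝓝[<] (0:ℝ), -t < k :=
      nhdsWithin_le_nhds (lt_mem_nhds (by linarith))
    have hlim : Tendsto (fun k : ℝ => k⁻¹ • (Φ (t + k) t (xu (t + k)) - xu t)) (𝓝[<] 0)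
        (𝓝 (Fu t (xu t) - F t (xu t))) := by
      rw [Metric.tendsto_nhds]
      intro ε hε
      have hsm : ∀ᶠ k in 𝓝[<] (0:ℝ), C * L * (C * B * E) * (-k) < ε / 2 := by
        have : Tendsto (fun k : ℝ => C * L * (C * B * E) * (-k)) (𝓝 0)
            (𝓝 (C * L * (C * B * E) * (-0))) :=
          (by fun_prop : Continuous fun k : ℝ => C * L * (C * B * E) * (-k)).tendsto 0
        rw [neg_zero, mul_zero] at this
        exact (this.mono_left nhdsWithin_le_nhds).eventually (gt_mem_nhds (by positivity))
      filter_upwards [hleb (ε / 2) (by positivity), hsm, hkt, self_mem_nhdsWithin]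
        with k k1 k2 k3 k4
      have k4 : k < 0 := k4
      have k5 := (hdev (t + k) t (by linarith) (by linarith) ht.2).2
      rw [show t - (t + k) = -k by ring] at k5
      rw [dist_eq_norm]
      set I := ∫ τ in (t + k)..t, S (t - τ) (Fu τ (xu τ) - F τ (xu τ)) with hI
      set W := Fu t (xu t) - F t (xu t) with hW
      have e : k⁻¹ • (Φ (t + k) t (xu (t + k)) - xu t) - W =
          (-k)⁻¹ • ((xu t - Φ (t + k) t (xu (t + k)) - I) + (I - (-k) • W)) := by
        rw [sub_add_sub_cancel, smul_sub (-k)⁻¹ _ ((-k) • W), inv_smul_smul₀ (neg_ne_zero.2 k4.ne),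
          inv_neg, neg_smul, ← smul_neg, neg_sub]
      rw [e, norm_smul, norm_inv, Real.norm_eq_abs, abs_of_pos (by linarith),
        inv_mul_lt_iff₀ (by linarith)]
      refine (norm_add_le _ _).trans_lt ?_
      have hk' : 0 < -k := by linarith
      have := mul_lt_mul_of_pos_right k2 hk'
      nlinarith
    have hd0 : Tendsto (fun k : ℝ => Φ (t + k) t (xu (t + k)) - xu t) (𝓝[<] 0) (𝓝 0) := by
      have h0 : Tendsto (fun k : ℝ => k) (𝓝[<] 0) (𝓝 0) := nhdsWithin_le_nhds
      have := h0.smul hlim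
      rw [zero_smul] at this
      refine this.congr' ?_
      filter_upwards [self_mem_nhdsWithin] with k hk
      exact smul_inv_smul₀ (ne_of_lt hk) _
    have h2 := (hasFDerivWithinAt_univ.2 hp.hasFDerivAt).lim (c := fun k : ℝ => k⁻¹) hd0
      (Eventually.of_forall fun _ => mem_univ _) hlim
    refine tendsto_nhds_unique h1 (h2.congr' ?_)
    filter_upwards [hkt, self_mem_nhdsWithin] with k k1 k2
    have k2 : k < 0 := k2
    simp only [add_sub_cancel, hg]
    rw [hflow (t + k) t (by linarith) (by linarith) ht.2]
  -- conclusion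
  have hintg := hac.integral_deriv_eq_sub
  have hii := hac.intervalIntegrable_deriv
  rw [intervalIntegrable_iff_integrableOn_Icc_of_le hT.le] at hii
  rw [intervalIntegral.integral_of_le hT.le, ← integral_Icc_eq_integral_Ioc] at hintg
  have hsqi : ∀ v : ℝ → EuclideanSpace ℝ (Fin m),
      AEStronglyMeasurable v (volume.restrict (Icc (0:ℝ) T)) →
      (∀ᵐ t ∂(volume.restrict (Icc (0:ℝ) T)), ‖v t‖ ≤ R) →
      Integrable (fun t => ‖v t‖ ^ 2) (volume.restrict (Icc (0:ℝ) T)) := by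
    intro v hv hb
    refine Integrable.of_bound (hv.norm.pow 2) (R ^ 2) ?_
    filter_upwards [hb] with t ht
    rw [norm_pow, norm_norm]
    gcongr
  have i1 := hsqi u hu_meas hub
  have i2 := hsqi ubar hubar_meas hubb
  have hle : ∫ t in Icc (0:ℝ) T, deriv g t ≤
      ∫ t in Icc (0:ℝ) T, (α / 2 * ‖ubar t‖ ^ 2 - α / 2 * ‖u t‖ ^ 2) := by
    refine integral_mono_ae hii ((i2.const_mul _).sub (i1.const_mul _)) ?_
    filter_upwards [hder, hH] with t h1 h2
    have e : Fu t (xu t) - F t (xu t) = G t (xu t) (u t) - G t (xu t) (ubar t) := by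
      simp only [hFdef, hFudef]; abel
    rw [h1, e, map_sub]
    linarith
  rw [integral_sub (i2.const_mul _) (i1.const_mul _), integral_const_mul, integral_const_mul,
    hintg] at hle
  have hgT : g T = ℓ (xu T) := by
    simp only [hg]
    rw [mild_init hS le_rfl (hΦ T ⟨hT.le, le_rfl⟩ (xu T))]
  have hg0 : g 0 = ℓ (Φ 0 T x₀) := by
    simp only [hg]
    rw [mild_init hS hT.le hxu]
  rw [hgT, hg0] at hle
  linarith
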